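/- arXiv:2505.22875 — 3 statements merged into one kernel-verified Lean document; each statement's English description precedes it below -/
import Mathlib

section
/- Fix n ≥ 1 and let η_n, η̃_n, τ_n be probability distributions on the family 𝔽_n of labelled graphs on the vertex set {1,…,n}. For G ∈ 𝔽_n set β_n(G) = ∑_{H ∈ 𝔽_n : E(G)∩E(H)=∅} τ_n(H), and suppose that β_n(G) > 0 for every G ∈ 𝔽_n and that there exists γ > 0 with β_n(G) ≤ γ·β_n(G') for all G, G' ∈ 𝔽_n. Then d_TV(η_n ⊕ τ_n, η̃_n ⊕ τ_n) ≤ 2γ·d_TV(η_n, η̃_n). -/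
open Filter Topology

/-- Degree of a vertex in a graph on `Fin n`. -/
noncomputable def gDeg {n : ℕ} (G : SimpleGraph (Fin n)) (v : Fin n) : ℕ :=
  Nat.card {w : Fin n // G.Adj v w}

/-- `G` is a `d`-regular graph. -/
def IsRegularGraph {n : ℕ} (G : SimpleGraph (Fin n)) (d : ℕ) : Prop :=
  ∀ v, gDeg G v = d

open scoped Classical in
/-- The uniform probability distribution `μ_{d,n}` on the `d`-regular graphs on `{1,…,n}`. -/
noncomputable def mu (n d : ℕ) : SimpleGraph (Fin n) → ℝ := fun G =>
  if IsRegularGraph G d then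
    (Nat.card {H : SimpleGraph (Fin n) // IsRegularGraph H d} : ℝ)⁻¹
  else 0

/-- `p` is a probability distribution on a finite or countable space. -/
def IsProbC {α : Type*} (p : α → ℝ) : Prop :=
  (∀ x, 0 ≤ p x) ∧ ∑' x, p x = 1

/-- Probability of an event `A` under the distribution `p`. -/
noncomputable def probOf {α : Type*} (p : α → ℝ) (A : Set α) : ℝ := ∑' x : A, p x

/-- Total variation distance. -/
noncomputable def tvDist {α : Type*} (p q : α → ℝ) : ℝ := (1/2) * ∑' x, |p x - q x|

/-- `π` is a coupling of `p` and `q`. -/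
def IsCoupling {α β : Type*} (π : α × β → ℝ) (p : α → ℝ) (q : β → ℝ) : Prop :=
  IsProbC π ∧ (∀ a, ∑' b, π (a, b) = p a) ∧ (∀ b, ∑' a, π (a, b) = q b)

/-- Expectation of `f` under the distribution `p`. -/
noncomputable def expec {α : Type*} (p f : α → ℝ) : ℝ := ∑' x, p x * f x

open scoped Classical in
/-- Unnormalised mass of `p ⊕ q` at `G`: sum over ordered pairs of edge-disjoint graphs
with union `G`. -/
noncomputable def oplusMass {n : ℕ} (p q : SimpleGraph (Fin n) → ℝ)
    (G : SimpleGraph (Fin n)) : ℝ :=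
  ∑' H : SimpleGraph (Fin n) × SimpleGraph (Fin n),
    if Disjoint H.1 H.2 ∧ H.1 ⊔ H.2 = G then p H.1 * q H.2 else 0

/-- The distribution `p ⊕ q`. -/
noncomputable def oplus {n : ℕ} (p q : SimpleGraph (Fin n) → ℝ) :
    SimpleGraph (Fin n) → ℝ :=
  fun G => oplusMass p q G / ∑' H, oplusMass p q H

open scoped Classical in
/-- `β(τ, G) = ∑_{H : E(G) ∩ E(H) = ∅} τ(H)`. -/
noncomputable def betaMass {n : ℕ} (τ : SimpleGraph (Fin n) → ℝ)
    (G : SimpleGraph (Fin n)) : ℝ :=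
  ∑' H : SimpleGraph (Fin n), if Disjoint G H then τ H else 0

/-- Pushing two probability vectors through a nonnegative kernel with row sums `b` and
normalising the results increases their `ℓ¹` distance by a factor of at most `2 γ`, provided the
row sums are positive and compare up to the factor `γ`. -/
theorem sum_abs_normalized_kernel_sub_le {α β : Type*} [Fintype α] [Fintype β]
    (K : α → β → ℝ) (hK : ∀ a x, 0 ≤ K a x) (b : α → ℝ) (hb : ∀ a, ∑ x, K a x = b a)
    (p p' : α → ℝ) (hp : ∀ a, 0 ≤ p a) (hp' : ∀ a, 0 ≤ p' a)
    (hp1 : ∑ a, p a = 1) (hp1' : ∑ a, p' a = 1) (γ : ℝ)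
    (hpos : ∀ a, 0 < b a) (hγ : ∀ a a', b a ≤ γ * b a') :
    ∑ x, |(∑ a, p a * K a x) / (∑ y, ∑ a, p a * K a y)
        - (∑ a, p' a * K a x) / (∑ y, ∑ a, p' a * K a y)| ≤ 2 * γ * ∑ a, |p a - p' a| := by
  have total (q : α → ℝ) : ∑ y, ∑ a, q a * K a y = ∑ a, q a * b a := by
    rw [Finset.sum_comm]
    simp_rw [← Finset.mul_sum, hb]
  have total_pos (q : α → ℝ) (hq : ∀ a, 0 ≤ q a) (hq1 : ∑ a, q a = 1) :
      0 < ∑ a, q a * b a := by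
    obtain ⟨a, -, ha⟩ : ∃ a ∈ Finset.univ, q a ≠ 0 :=
      Finset.exists_ne_zero_of_sum_ne_zero (by rw [hq1]; exact one_ne_zero)
    exact Finset.sum_pos' (fun c _ => mul_nonneg (hq c) (hpos c).le)
      ⟨a, Finset.mem_univ a, mul_pos ((hq a).lt_of_ne' ha) (hpos a)⟩
  have hZ := total_pos p hp hp1
  have hZ' := total_pos p' hp' hp1'
  have hT' := total p'
  rw [total p, hT']
  set Z := ∑ a, p a * b a with hZdef
  set Z' := ∑ a, p' a * b a with hZdef'
  have b_le (a : α) : b a ≤ γ * Z := by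
    calc b a = ∑ c, p c * b a := by rw [← Finset.sum_mul, hp1, one_mul]
      _ ≤ ∑ c, p c * (γ * b c) :=
        Finset.sum_le_sum fun c _ => mul_le_mul_of_nonneg_left (hγ a c) (hp c)
      _ = γ * Z := by
        rw [hZdef, Finset.mul_sum]
        exact Finset.sum_congr rfl fun c _ => by ring
  have weighted : ∑ a, |p a - p' a| * b a ≤ γ * Z * ∑ a, |p a - p' a| := by
    rw [Finset.mul_sum]
    refine Finset.sum_le_sum fun a _ => ?_
    rw [mul_comm]
    exact mul_le_mul_of_nonneg_right (b_le a) (abs_nonneg _)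
  have diff_mass : ∑ x, |∑ a, p a * K a x - ∑ a, p' a * K a x| ≤ ∑ a, |p a - p' a| * b a := by
    rw [← total fun a => |p a - p' a|]
    refine Finset.sum_le_sum fun x _ => ?_
    rw [← Finset.sum_sub_distrib]
    refine (Finset.abs_sum_le_sum_abs _ _).trans (Finset.sum_le_sum fun a _ => ?_)
    rw [← sub_mul, abs_mul, abs_of_nonneg (hK a x)]
  have diff_total : |Z' - Z| ≤ ∑ a, |p a - p' a| * b a := by
    rw [abs_sub_comm, hZdef, hZdef', ← Finset.sum_sub_distrib]
    refine (Finset.abs_sum_le_sum_abs _ _).trans (Finset.sum_le_sum fun a _ => ?_)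
    rw [← sub_mul, abs_mul, abs_of_pos (hpos a)]
  have pointwise (x : β) : |(∑ a, p a * K a x) / Z - (∑ a, p' a * K a x) / Z'| ≤
      |∑ a, p a * K a x - ∑ a, p' a * K a x| / Z
        + (∑ a, p' a * K a x) * (|Z' - Z| / (Z * Z')) := by
    have h : (∑ a, p a * K a x) / Z - (∑ a, p' a * K a x) / Z'
        = (∑ a, p a * K a x - ∑ a, p' a * K a x) / Z
          + (∑ a, p' a * K a x) * ((Z' - Z) / (Z * Z')) := by
      field_simp
      ring
    rw [h]
    refine (abs_add_le _ _).trans_eq ?_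
    rw [abs_div, abs_mul, abs_div, abs_of_pos hZ, abs_of_pos (mul_pos hZ hZ'),
      abs_of_nonneg (Finset.sum_nonneg fun a _ => mul_nonneg (hp' a) (hK a x))]
  refine (Finset.sum_le_sum fun x _ => pointwise x).trans ?_
  rw [Finset.sum_add_distrib, ← Finset.sum_div, ← Finset.sum_mul, hT']
  have h : Z' * (|Z' - Z| / (Z * Z')) = |Z' - Z| / Z := by field_simp
  rw [h, ← add_div, div_le_iff₀ hZ]
  linarith

open scoped Classical in
/-- The `τ`-mass of the graphs edge-disjoint from `H` whose union with `H` is `G`. -/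
noncomputable def unionKernel {n : ℕ} (τ : SimpleGraph (Fin n) → ℝ)
    (H G : SimpleGraph (Fin n)) : ℝ :=
  ∑ H', if Disjoint H H' ∧ H ⊔ H' = G then τ H' else 0

theorem unionKernel_nonneg {n : ℕ} {τ : SimpleGraph (Fin n) → ℝ} (hτ : ∀ G, 0 ≤ τ G)
    (H G : SimpleGraph (Fin n)) : 0 ≤ unionKernel τ H G := by
  classical
  refine Finset.sum_nonneg fun H' _ => ?_
  split_ifs
  exacts [hτ H', le_rfl]

theorem sum_unionKernel {n : ℕ} (τ : SimpleGraph (Fin n) → ℝ) (H : SimpleGraph (Fin n)) :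
    ∑ G, unionKernel τ H G = betaMass τ H := by
  classical
  unfold unionKernel betaMass
  rw [tsum_fintype, Finset.sum_comm]
  refine Finset.sum_congr rfl fun H' _ => ?_
  by_cases h : Disjoint H H' <;> simp [h]

theorem oplusMass_eq_sum_unionKernel {n : ℕ} (p τ : SimpleGraph (Fin n) → ℝ)
    (G : SimpleGraph (Fin n)) : oplusMass p τ G = ∑ H, p H * unionKernel τ H G := by
  classical
  unfold oplusMass unionKernel
  rw [tsum_fintype, Fintype.sum_prod_type]
  simp_rw [Finset.mul_sum, mul_ite, mul_zero]

/-- If `β_n(G) > 0` and `β_n(G) ≤ γ β_n(G')` for all `G, G'`, then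
`d_TV(η ⊕ τ, η̃ ⊕ τ) ≤ 2γ d_TV(η, η̃)`. -/
theorem statement_7 {n : ℕ} (hn : 1 ≤ n)
    (η η' τ : SimpleGraph (Fin n) → ℝ)
    (hη : IsProbC η) (hη' : IsProbC η') (hτ : IsProbC τ)
    (γ : ℝ) (hγ : 0 < γ)
    (hβpos : ∀ G : SimpleGraph (Fin n), 0 < betaMass τ G)
    (hβ : ∀ G G' : SimpleGraph (Fin n), betaMass τ G ≤ γ * betaMass τ G') :
    tvDist (oplus η τ) (oplus η' τ) ≤ 2 * γ * tvDist η η' := by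
  classical
  have hη1 := hη.2
  have hη1' := hη'.2
  rw [tsum_fintype] at hη1 hη1'
  have h := sum_abs_normalized_kernel_sub_le (unionKernel τ) (unionKernel_nonneg hτ.1)
    (betaMass τ) (sum_unionKernel τ) η η' hη.1 hη'.1 hη1 hη1' γ hβpos hβ
  simp only [tvDist, oplus, tsum_fintype, oplusMass_eq_sum_unionKernel]
  linarith
end

section
/- For each n ≥ 1 let η_n, η̃_n, τ_n be probability distributions on the family 𝔽_n of labelled graphs on the vertex set {1,…,n}; set β_n(G) = ∑_{H ∈ 𝔽_n : E(G)∩E(H)=∅} τ_n(H), and suppose β_n(G) > 0 for all n and all G ∈ 𝔽_n and that there is a constant γ > 0, independent of n, with β_n(G) ≤ γ·β_n(G') for all n and all G, G' ∈ 𝔽_n. If the sequences (η_n)_{n≥1} and (η̃_n)_{n≥1} are contiguous, then the sequences (η_n ⊕ τ_n)_{n≥1} and (η̃_n ⊕ τ_n)_{n≥1} are contiguous as well. -/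
open Filter Topology

/-- Two sequences of probability measures are contiguous. -/
def Contiguous {Ω : ℕ → Type*} (p q : (n : ℕ) → Ω n → ℝ) : Prop :=
  ∀ A : (n : ℕ) → Set (Ω n),
    (Tendsto (fun n => probOf (p n) (A n)) atTop (𝓝 1) ↔
     Tendsto (fun n => probOf (q n) (A n)) atTop (𝓝 1))

/-- The mass that `τ` gives to the graphs that are edge-disjoint from `G` and whose union
with `G` lies in `B`. -/
noncomputable def unionMass {n : ℕ} (τ : SimpleGraph (Fin n) → ℝ)
    (B : Set (SimpleGraph (Fin n))) (G : SimpleGraph (Fin n)) : ℝ :=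
  open scoped Classical in
  ∑ H : SimpleGraph (Fin n), if Disjoint G H ∧ G ⊔ H ∈ B then τ H else 0

theorem probOf_nonneg {α : Type*} {p : α → ℝ} (hp : ∀ x, 0 ≤ p x) (A : Set α) :
    0 ≤ probOf p A :=
  tsum_nonneg fun x => hp x

section Finite

variable {α : Type*} [Fintype α]

open scoped Classical in
theorem probOf_eq_sum (p : α → ℝ) (A : Set α) :
    probOf p A = ∑ x, if x ∈ A then p x else 0 := by
  rw [probOf, tsum_subtype A p, tsum_fintype]
  simp only [Set.indicator_apply]

theorem IsProbC.sum_eq_one {p : α → ℝ} (hp : IsProbC p) : ∑ x, p x = 1 :=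
  (tsum_fintype p).symm.trans hp.2

theorem probOf_add_compl (p : α → ℝ) (A : Set α) :
    probOf p A + probOf p Aᶜ = ∑ x, p x := by
  classical
  rw [probOf_eq_sum, probOf_eq_sum, ← Finset.sum_add_distrib]
  refine Finset.sum_congr rfl fun x _ => ?_
  by_cases hx : x ∈ A <;> simp [hx]

/-- Markov's inequality. -/
theorem mul_probOf_lt_le_sum {p c : α → ℝ} (hp : ∀ x, 0 ≤ p x) (hc : ∀ x, 0 ≤ c x) (ε : ℝ) :
    ε * probOf p {x | ε < c x} ≤ ∑ x, p x * c x := by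
  classical
  rw [probOf_eq_sum, Finset.mul_sum]
  refine Finset.sum_le_sum fun x _ => ?_
  by_cases hx : ε < c x
  · simpa [hx, mul_comm] using mul_le_mul_of_nonneg_left hx.le (hp x)
  · simpa [hx] using mul_nonneg (hp x) (hc x)

theorem sum_le_add_probOf_lt {p c : α → ℝ} (hp : IsProbC p) (hc : ∀ x, c x ≤ 1) {ε : ℝ}
    (hε : 0 ≤ ε) : ∑ x, p x * c x ≤ ε + probOf p {x | ε < c x} := by
  classical
  have hε' : ε = ∑ x, p x * ε := by rw [← Finset.sum_mul, hp.sum_eq_one, one_mul]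
  rw [probOf_eq_sum]
  nth_rewrite 1 [hε']
  rw [← Finset.sum_add_distrib]
  refine Finset.sum_le_sum fun x _ => ?_
  by_cases hx : ε < c x
  · simp only [Set.mem_ofPred_eq, hx, if_true]
    nlinarith [mul_nonneg (hp.1 x) hε, mul_le_mul_of_nonneg_left (hc x) (hp.1 x)]
  · simpa [hx] using mul_le_mul_of_nonneg_left (not_lt.1 hx) (hp.1 x)

end Finite

theorem Contiguous.symm {Ω : ℕ → Type*} {p q : (n : ℕ) → Ω n → ℝ} (h : Contiguous p q) :
    Contiguous q p :=
  fun A => (h A).symm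

/-- Expectations of `[0, 1]`-valued functions that vanish asymptotically under `p` also
vanish asymptotically under a contiguous `q`. -/
theorem Contiguous.tendsto_sum_zero {Ω : ℕ → Type*} [∀ n, Fintype (Ω n)]
    {p q : (n : ℕ) → Ω n → ℝ} (h : Contiguous p q) (hp : ∀ n, IsProbC (p n))
    (hq : ∀ n, IsProbC (q n)) {c : (n : ℕ) → Ω n → ℝ} (hc₀ : ∀ n x, 0 ≤ c n x)
    (hc₁ : ∀ n x, c n x ≤ 1) (hlim : Tendsto (fun n => ∑ x, p n x * c n x) atTop (𝓝 0)) :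
    Tendsto (fun n => ∑ x, q n x * c n x) atTop (𝓝 0) := by
  have key : ∀ ε > 0, Tendsto (fun n => probOf (q n) {x | ε < c n x}) atTop (𝓝 0) := by
    intro ε hε
    have hp0 : Tendsto (fun n => probOf (p n) {x | ε < c n x}) atTop (𝓝 0) := by
      refine squeeze_zero (fun n => probOf_nonneg (hp n).1 _) (fun n => ?_)
        (by simpa using hlim.div_const ε)
      rw [le_div_iff₀ hε, mul_comm]
      exact mul_probOf_lt_le_sum (hp n).1 (hc₀ n) ε
    have compl_eq : ∀ {r : (n : ℕ) → Ω n → ℝ}, (∀ n, IsProbC (r n)) → ∀ n,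
        probOf (r n) {x | ε < c n x}ᶜ = 1 - probOf (r n) {x | ε < c n x} := fun hr n => by
      rw [← (hr n).sum_eq_one, ← probOf_add_compl _ {x | ε < c n x}, add_sub_cancel_left]
    have hq1 := (h fun n => {x | ε < c n x}ᶜ).1 (by
      simp only [compl_eq hp]
      simpa using hp0.const_sub 1)
    simp only [compl_eq hq] at hq1
    simpa using hq1.const_sub 1
  refine tendsto_order.2 ⟨fun a ha => Eventually.of_forall fun n => ha.trans_le <|
    Finset.sum_nonneg fun x _ => mul_nonneg ((hq n).1 x) (hc₀ n x), fun ε hε => ?_⟩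
  filter_upwards [(key (ε / 2) (half_pos hε)).eventually_lt_const (half_pos hε)] with n hn
  linarith [sum_le_add_probOf_lt (hq n) (hc₁ n) (half_pos hε).le]

section Graphs

variable {n : ℕ}

theorem unionMass_univ (τ : SimpleGraph (Fin n) → ℝ) (G : SimpleGraph (Fin n)) :
    unionMass τ Set.univ G = betaMass τ G := by
  rw [unionMass, betaMass, tsum_fintype]
  refine Finset.sum_congr rfl fun H _ => ?_
  by_cases h : Disjoint G H <;> simp [h]

theorem betaMass_bot {τ : SimpleGraph (Fin n) → ℝ} (hτ : IsProbC τ) : betaMass τ ⊥ = 1 := by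
  simpa [betaMass] using hτ.sum_eq_one

theorem unionMass_nonneg {τ : SimpleGraph (Fin n) → ℝ} (hτ : IsProbC τ)
    (B : Set (SimpleGraph (Fin n))) (G : SimpleGraph (Fin n)) : 0 ≤ unionMass τ B G := by
  classical
  refine Finset.sum_nonneg fun H _ => ?_
  split_ifs
  exacts [hτ.1 H, le_rfl]

theorem unionMass_le_one {τ : SimpleGraph (Fin n) → ℝ} (hτ : IsProbC τ)
    (B : Set (SimpleGraph (Fin n))) (G : SimpleGraph (Fin n)) : unionMass τ B G ≤ 1 := by
  classical
  rw [← hτ.sum_eq_one]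
  refine Finset.sum_le_sum fun H _ => ?_
  split_ifs
  exacts [le_rfl, hτ.1 H]

theorem probOf_oplusMass (p τ : SimpleGraph (Fin n) → ℝ) (B : Set (SimpleGraph (Fin n))) :
    probOf (oplusMass p τ) B = ∑ G, p G * unionMass τ B G := by
  classical
  simp only [probOf_eq_sum, oplusMass, unionMass, tsum_fintype, Finset.mul_sum]
  rw [← Fintype.sum_prod_type' (f := fun G H => p G * if Disjoint G H ∧ G ⊔ H ∈ B then τ H else 0)]
  have push (G : SimpleGraph (Fin n)) (f : SimpleGraph (Fin n) × SimpleGraph (Fin n) → ℝ) :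
      (if G ∈ B then ∑ H, f H else 0) = ∑ H, if G ∈ B then f H else 0 := by
    split_ifs <;> simp
  simp only [push]
  rw [Finset.sum_comm]
  refine Finset.sum_congr rfl fun H _ => ?_
  rw [Finset.sum_eq_single (H.1 ⊔ H.2)]
  · by_cases h₁ : Disjoint H.1 H.2 <;> by_cases h₂ : H.1 ⊔ H.2 ∈ B <;> simp [h₁, h₂]
  · intro G _ hG
    simp [hG.symm]
  · simp

theorem probOf_oplus (p τ : SimpleGraph (Fin n) → ℝ) (B : Set (SimpleGraph (Fin n))) :
    probOf (oplus p τ) B = (∑ G, p G * unionMass τ B G) / ∑ G, p G * betaMass τ G := by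
  have hZ : ∑' H, oplusMass p τ H = ∑ G, p G * betaMass τ G := by
    simp only [← unionMass_univ, ← probOf_oplusMass]
    exact (tsum_univ _).symm
  rw [← probOf_oplusMass, ← hZ, probOf, probOf, ← tsum_div_const]
  rfl

/-- The normalising constant of `p ⊕ τ` lies in `[γ⁻¹, 1]`. -/
theorem sum_mul_betaMass_mem_Icc {p τ : SimpleGraph (Fin n) → ℝ} (hp : IsProbC p)
    (hτ : IsProbC τ) {γ : ℝ} (hγ : 0 < γ)
    (hβ : ∀ G G' : SimpleGraph (Fin n), betaMass τ G ≤ γ * betaMass τ G') :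
    ∑ G, p G * betaMass τ G ∈ Set.Icc γ⁻¹ 1 := by
  constructor
  · rw [← one_mul γ⁻¹, ← hp.sum_eq_one, Finset.sum_mul]
    refine Finset.sum_le_sum fun G _ => mul_le_mul_of_nonneg_left ?_ (hp.1 G)
    rw [inv_le_iff_one_le_mul₀' hγ, ← betaMass_bot hτ]
    exact hβ ⊥ G
  · rw [← hp.sum_eq_one]
    refine Finset.sum_le_sum fun G _ => mul_le_of_le_one_right (hp.1 G) ?_
    rw [← unionMass_univ]
    exact unionMass_le_one hτ _ G

end Graphs

theorem tendsto_probOf_oplus_one_iff {p τ : (n : ℕ) → SimpleGraph (Fin n) → ℝ}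
    (hp : ∀ n, IsProbC (p n)) (hτ : ∀ n, IsProbC (τ n)) {γ : ℝ} (hγ : 0 < γ)
    (hβ : ∀ n, ∀ G G' : SimpleGraph (Fin n), betaMass (τ n) G ≤ γ * betaMass (τ n) G')
    (A : (n : ℕ) → Set (SimpleGraph (Fin n))) :
    Tendsto (fun n => probOf (oplus (p n) (τ n)) (A n)) atTop (𝓝 1) ↔
      Tendsto (fun n => ∑ G, p n G * unionMass (τ n) (A n)ᶜ G) atTop (𝓝 0) := by
  have hZ n := sum_mul_betaMass_mem_Icc (hp n) (hτ n) hγ (hβ n)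
  have hZpos n : 0 < ∑ G, p n G * betaMass (τ n) G := (inv_pos.2 hγ).trans_le (hZ n).1
  have hE n : 0 ≤ ∑ G, p n G * unionMass (τ n) (A n)ᶜ G :=
    Finset.sum_nonneg fun G _ => mul_nonneg ((hp n).1 G) (unionMass_nonneg (hτ n) _ G)
  have hprob n : probOf (oplus (p n) (τ n)) (A n) =
      1 - (∑ G, p n G * unionMass (τ n) (A n)ᶜ G) / ∑ G, p n G * betaMass (τ n) G := by
    have h1 : ∑ G, p n G * betaMass (τ n) G = ∑ G, p n G * unionMass (τ n) (A n) G +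
        ∑ G, p n G * unionMass (τ n) (A n)ᶜ G := by
      simp only [← unionMass_univ, ← probOf_oplusMass]
      rw [probOf_add_compl, probOf_eq_sum]
      simp
    rw [probOf_oplus, eq_sub_iff_add_eq, ← add_div, ← h1, div_self (hZpos n).ne']
  simp only [hprob]
  constructor
  · intro h
    refine squeeze_zero hE (fun n => ?_) (by simpa using h.const_sub 1)
    exact (le_div_iff₀ (hZpos n)).2 (mul_le_of_le_one_right (hE n) (hZ n).2)
  · intro h
    have h0 : Tendsto (fun n => (∑ G, p n G * unionMass (τ n) (A n)ᶜ G) /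
        ∑ G, p n G * betaMass (τ n) G) atTop (𝓝 0) := by
      refine squeeze_zero (fun n => div_nonneg (hE n) (hZpos n).le) (fun n => ?_)
        (by simpa using h.mul_const γ)
      rw [div_eq_mul_inv]
      exact mul_le_mul_of_nonneg_left (inv_le_of_inv_le₀ hγ (hZ n).1) (hE n)
    simpa using h0.const_sub 1

/-- Under the conditions on `β_n` (positivity and uniform comparability
with a constant `γ` independent of `n`), if `(η_n)` and `(η̃_n)` are contiguous, then
`(η_n ⊕ τ_n)` and `(η̃_n ⊕ τ_n)` are contiguous as well. -/
theorem statement_8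
    (η η' τ : (n : ℕ) → SimpleGraph (Fin n) → ℝ)
    (hη : ∀ n, IsProbC (η n)) (hη' : ∀ n, IsProbC (η' n)) (hτ : ∀ n, IsProbC (τ n))
    (γ : ℝ) (hγ : 0 < γ)
    (hβpos : ∀ n, ∀ G : SimpleGraph (Fin n), 0 < betaMass (τ n) G)
    (hβ : ∀ n, ∀ G G' : SimpleGraph (Fin n), betaMass (τ n) G ≤ γ * betaMass (τ n) G')
    (hc : Contiguous η η') :
    Contiguous (fun n => oplus (η n) (τ n)) (fun n => oplus (η' n) (τ n)) := by
  intro A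
  rw [tendsto_probOf_oplus_one_iff hη hτ hγ hβ, tendsto_probOf_oplus_one_iff hη' hτ hγ hβ]
  have h₀ n := unionMass_nonneg (hτ n) (A n)ᶜ
  have h₁ n := unionMass_le_one (hτ n) (A n)ᶜ
  exact ⟨hc.tendsto_sum_zero hη hη' h₀ h₁, hc.symm.tendsto_sum_zero hη' hη h₀ h₁⟩
end

section
/- There exists an absolute constant C > 0 with the following property. For each n ≥ 1, let k = k(n) ≥ 2 and let d_1(n), …, d_k(n) ≥ 1 be integers with d_i·n even for each i and with sum D = D(n) satisfying D^3 ≤ n; let η_n and η̃_n be probability measures on 𝒢_{d_1}(n), and set τ_n = μ_{d_2,n} ⊕ ⋯ ⊕ μ_{d_k,n}. Then for every n ≥ 1, d_TV(η_n ⊕ τ_n, η̃_n ⊕ τ_n) ≤ C·d_TV(η_n, η̃_n). -/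
open Filter Topology

open scoped Classical in
/-- Unnormalised mass of the `k`-fold sum `p 0 ⊕ ⋯ ⊕ p (k-1)` at `G`: sum over ordered
`k`-tuples of pairwise edge-disjoint graphs with union `G`. -/
noncomputable def oplusFoldMass {n : ℕ} (k : ℕ) (p : Fin k → SimpleGraph (Fin n) → ℝ)
    (G : SimpleGraph (Fin n)) : ℝ :=
  ∑' f : Fin k → SimpleGraph (Fin n),
    if (∀ i j, i ≠ j → Disjoint (f i) (f j)) ∧ (⨆ i, f i) = G then
      ∏ i, p i (f i)
    else 0

/-- The `k`-fold distribution `p 0 ⊕ ⋯ ⊕ p (k-1)`. -/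
noncomputable def oplusFold {n : ℕ} (k : ℕ) (p : Fin k → SimpleGraph (Fin n) → ℝ) :
    SimpleGraph (Fin n) → ℝ :=
  fun G => oplusFoldMass k p G / ∑' H, oplusFoldMass k p H

namespace RegularPacking

open scoped Classical

variable {V ι : Type*} [Fintype V]

/-- A family of pairwise edge-disjoint graphs, the `i`-th one `d i`-regular, all of them
edge-disjoint from `F`. -/
structure IsPacking (d : ι → ℕ) (F : SimpleGraph V) (f : ι → SimpleGraph V) : Prop where
  degree : ∀ i v, (f i).degree v = d i
  color_unique : ∀ i j u v, (f i).Adj u v → (f j).Adj u v → i = j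
  not_adj : ∀ i u v, (f i).Adj u v → ¬ F.Adj u v

/-- Replace the edges `xy`, `ab` by `xa`, `yb`. -/
def switch (G : SimpleGraph V) (x y a b : V) : SimpleGraph V :=
  G.deleteEdges {s(x, y), s(a, b)} ⊔ SimpleGraph.fromEdgeSet {s(x, a), s(y, b)}

omit [Fintype V] in
lemma switch_adj {G : SimpleGraph V} {x y a b u v : V} :
    (switch G x y a b).Adj u v ↔
      (G.Adj u v ∧ s(u, v) ≠ s(x, y) ∧ s(u, v) ≠ s(a, b)) ∨
        ((s(u, v) = s(x, a) ∨ s(u, v) = s(y, b)) ∧ u ≠ v) := by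
  simp only [switch, SimpleGraph.sup_adj, SimpleGraph.deleteEdges_adj,
    SimpleGraph.fromEdgeSet_adj, Set.mem_insert_iff, Set.mem_singleton_iff, not_or]

lemma degree_eq_of_perm {G G' : SimpleGraph V} (v : V) (σ : Equiv.Perm V)
    (h : ∀ w, G'.Adj v (σ w) ↔ G.Adj v w) : G'.degree v = G.degree v := by
  rw [← SimpleGraph.card_neighborFinset_eq_degree, ← SimpleGraph.card_neighborFinset_eq_degree,
    ← Finset.card_map σ.toEmbedding (s := G.neighborFinset v)]
  congr 1
  ext w
  obtain ⟨w, rfl⟩ := σ.surjective w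
  simp [h]

lemma degree_switch {G : SimpleGraph V} {x y a b : V} (hxy : G.Adj x y) (hab : G.Adj a b)
    (hxa : x ≠ a) (hyb : y ≠ b) (nxa : ¬ G.Adj x a) (nyb : ¬ G.Adj y b) (v : V) :
    (switch G x y a b).degree v = G.degree v := by
  have hne := hxy.ne
  have hne' := hab.ne
  have hxb : x ≠ b := by rintro rfl; exact nxa hab.symm
  have hya : y ≠ a := by rintro rfl; exact nxa hxy
  have s1 := hxy.symm
  have s2 := hab.symm
  have s3 : ¬ G.Adj a x := fun h => nxa h.symm
  have s4 : ¬ G.Adj b y := fun h => nyb h.symm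
  by_cases h1 : v = x
  · subst h1
    refine degree_eq_of_perm _ (Equiv.swap y a) fun w => ?_
    have := G.irrefl (v := v)
    simp only [switch_adj, Equiv.swap_apply_def, Sym2.eq_iff, ne_eq]
    grind
  by_cases h2 : v = y
  · subst h2
    refine degree_eq_of_perm _ (Equiv.swap x b) fun w => ?_
    have := G.irrefl (v := v)
    simp only [switch_adj, Equiv.swap_apply_def, Sym2.eq_iff, ne_eq]
    grind
  by_cases h3 : v = a
  · subst h3
    refine degree_eq_of_perm _ (Equiv.swap b x) fun w => ?_
    have := G.irrefl (v := v)
    simp only [switch_adj, Equiv.swap_apply_def, Sym2.eq_iff, ne_eq]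
    grind
  by_cases h4 : v = b
  · subst h4
    refine degree_eq_of_perm _ (Equiv.swap a y) fun w => ?_
    have := G.irrefl (v := v)
    simp only [switch_adj, Equiv.swap_apply_def, Sym2.eq_iff, ne_eq]
    grind
  refine degree_eq_of_perm _ (Equiv.refl V) fun w => ?_
  simp only [switch_adj, Equiv.refl_apply, Sym2.eq_iff, ne_eq]
  grind

/-- The edges `xy`, `ab` of `f i` may be switched to `xa`, `yb` without meeting `F` or another
edge of the family. -/
structure Switchable (F : SimpleGraph V) (f : ι → SimpleGraph V) (i : ι) (x y a b : V) :
    Prop where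
  adj₁ : (f i).Adj x y
  adj₂ : (f i).Adj a b
  ne₁ : x ≠ a
  ne₂ : y ≠ b
  not_adj₁ : ¬ F.Adj x a
  not_adj₂ : ¬ F.Adj y b
  not_mem₁ : ∀ l, ¬ (f l).Adj x a
  not_mem₂ : ∀ l, ¬ (f l).Adj y b

/-- Switch the `i`-th graph of a family. -/
noncomputable def switchAt (f : ι → SimpleGraph V) (i : ι) (x y a b : V) : ι → SimpleGraph V :=
  Function.update f i (switch (f i) x y a b)

omit [Fintype V] in
lemma switchAt_adj {f : ι → SimpleGraph V} {i l : ι} {x y a b u v : V} :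
    (switchAt f i x y a b l).Adj u v ↔
      ((f l).Adj u v ∧ (l = i → s(u, v) ≠ s(x, y) ∧ s(u, v) ≠ s(a, b))) ∨
        (l = i ∧ (s(u, v) = s(x, a) ∨ s(u, v) = s(y, b)) ∧ u ≠ v) := by
  by_cases h : l = i
  · subst h
    simp [switchAt, switch_adj]
  · simp [switchAt, h]

omit [Fintype V] in
lemma Switchable.switchAt_switchAt {F : SimpleGraph V} {f : ι → SimpleGraph V} {i : ι}
    {x y a b : V} (h : Switchable F f i x y a b) :
    switchAt (switchAt f i x y a b) i x a y b = f := by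
  obtain ⟨h1, h2, h3, h4, -, -, h5, h6⟩ := h
  have g1 := h1.symm
  have g2 := h2.symm
  have g5 : ∀ l, ¬ (f l).Adj a x := fun l h => h5 l h.symm
  have g6 : ∀ l, ¬ (f l).Adj b y := fun l h => h6 l h.symm
  have e1 := h1.ne
  have e2 := h2.ne
  funext l
  ext u v
  have e3 := fun h : (f l).Adj u v => h.ne
  simp only [switchAt_adj, Sym2.eq_iff, ne_eq]
  by_cases hl : l = i
  · subst hl
    specialize h5 l
    specialize h6 l
    specialize g5 l
    specialize g6 l
    grind
  · simp [hl]

lemma Switchable.isPacking {d : ι → ℕ} {F : SimpleGraph V} {f : ι → SimpleGraph V} {i : ι}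
    {x y a b : V} (h : Switchable F f i x y a b) (hf : IsPacking d F f) :
    IsPacking d F (switchAt f i x y a b) where
  degree l v := by
    by_cases hl : l = i
    · subst hl
      rw [← hf.degree l v, ← degree_switch h.adj₁ h.adj₂ h.ne₁ h.ne₂ (h.not_mem₁ l)
        (h.not_mem₂ l) v]
      exact degree_eq_of_perm v (Equiv.refl V) (by simp [switchAt])
    · rw [← hf.degree l v]
      exact degree_eq_of_perm v (Equiv.refl V) (by simp [switchAt, hl])
  color_unique l m u v := by
    have g := hf.color_unique l m u v
    have h5 := h.not_mem₁
    have h6 := h.not_mem₂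
    have g5 : ∀ l, ¬ (f l).Adj a x := fun l h => h5 l h.symm
    have g6 : ∀ l, ¬ (f l).Adj b y := fun l h => h6 l h.symm
    simp only [switchAt_adj, Sym2.eq_iff, ne_eq]
    grind
  not_adj l u v := by
    have g := hf.not_adj l u v
    have h5 := h.not_adj₁
    have h6 := h.not_adj₂
    have g5 : ¬ F.Adj a x := fun h => h5 h.symm
    have g6 : ¬ F.Adj b y := fun h => h6 h.symm
    simp only [switchAt_adj, Sym2.eq_iff, ne_eq]
    grind

omit [Fintype V] in
lemma Switchable.switchAt_adj₁ {F : SimpleGraph V} {f : ι → SimpleGraph V} {i : ι}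
    {x y a b : V} (h : Switchable F f i x y a b) : (switchAt f i x y a b i).Adj x a := by
  simp [switchAt_adj, h.ne₁]

omit [Fintype V] in
lemma Switchable.switchAt_adj₂ {F : SimpleGraph V} {f : ι → SimpleGraph V} {i : ι}
    {x y a b : V} (h : Switchable F f i x y a b) : (switchAt f i x y a b i).Adj y b := by
  simp [switchAt_adj, h.ne₂]

lemma Switchable.switchAt_not_adj {d : ι → ℕ} {F : SimpleGraph V} {f : ι → SimpleGraph V} {i : ι}
    {x y a b : V} (h : Switchable F f i x y a b) (hf : IsPacking d F f) (l : ι) :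
    ¬ (switchAt f i x y a b l).Adj x y := by
  have g := hf.color_unique l i x y
  obtain ⟨h1, h2, h3, h4, -, -, h5, h6⟩ := h
  have e1 := h1.ne
  have := h5 i
  have := h6 i
  have g2 := h2.symm
  simp only [switchAt_adj, Sym2.eq_iff, ne_eq]
  grind

variable [Fintype ι]

/-- The finite set of packings avoiding `F`. -/
noncomputable def packings (d : ι → ℕ) (F : SimpleGraph V) : Finset (ι → SimpleGraph V) :=
  Finset.univ.filter (IsPacking d F)

lemma mem_packings {d : ι → ℕ} {F : SimpleGraph V} {f : ι → SimpleGraph V} :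
    f ∈ packings d F ↔ IsPacking d F f := by
  simp [packings]

/-- The vertices equal or adjacent to `x` in `F` or in a member of the family `f`. -/
noncomputable def blocked (F : SimpleGraph V) (f : ι → SimpleGraph V) (x : V) : Finset V :=
  insert x (F.neighborFinset x ∪ Finset.univ.biUnion fun l => (f l).neighborFinset x)

lemma mem_blocked {F : SimpleGraph V} {f : ι → SimpleGraph V} {x y : V} :
    y ∈ blocked F f x ↔ y = x ∨ F.Adj x y ∨ ∃ l, (f l).Adj x y := by
  simp [blocked]

lemma card_blocked_le {d : ι → ℕ} {F : SimpleGraph V} {f : ι → SimpleGraph V} {g D : ℕ}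
    (hf : IsPacking d F f) (hF : ∀ v, F.degree v ≤ g) (hD : g + ∑ i, d i = D) (x : V) :
    (blocked F f x).card ≤ D + 1 := by
  have h1 := Finset.card_insert_le x
    (F.neighborFinset x ∪ Finset.univ.biUnion fun l => (f l).neighborFinset x)
  have h2 := Finset.card_union_le (F.neighborFinset x)
    (Finset.univ.biUnion fun l => (f l).neighborFinset x)
  have h3 := Finset.card_biUnion_le (s := Finset.univ) (t := fun l => (f l).neighborFinset x)
  have h4 : ∑ l, ((f l).neighborFinset x).card = ∑ l, d l :=
    Finset.sum_congr rfl fun l _ => by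
      rw [SimpleGraph.card_neighborFinset_eq_degree, hf.degree]
  have h5 := hF x
  rw [← SimpleGraph.card_neighborFinset_eq_degree] at h5
  unfold blocked
  omega

omit [Fintype ι] in
lemma IsPacking.card_neighborFinset {d : ι → ℕ} {F : SimpleGraph V} {f : ι → SimpleGraph V}
    (hf : IsPacking d F f) (i : ι) (v : V) : ((f i).neighborFinset v).card = d i := by
  rw [SimpleGraph.card_neighborFinset_eq_degree, hf.degree]

/-- The ordered pairs of adjacent vertices. -/
noncomputable def orientedEdges (G : SimpleGraph V) : Finset (V × V) :=
  Finset.univ.filter fun p => G.Adj p.1 p.2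

lemma mem_orientedEdges {G : SimpleGraph V} {p : V × V} :
    p ∈ orientedEdges G ↔ G.Adj p.1 p.2 := by
  simp [orientedEdges]

lemma card_orientedEdges_filter_fst {G : SimpleGraph V} {k : ℕ} (h : ∀ v, G.degree v = k)
    (S : Finset V) : ((orientedEdges G).filter fun p => p.1 ∈ S).card = S.card * k := by
  have : ((orientedEdges G).filter fun p => p.1 ∈ S) =
      (S.sigma fun v => G.neighborFinset v).map (Equiv.sigmaEquivProd V V).toEmbedding := by
    ext ⟨a, b⟩
    simp [orientedEdges, and_comm]
  rw [this, Finset.card_map, Finset.card_sigma,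
    Finset.sum_const_nat fun v _ => (G.card_neighborFinset_eq_degree v).trans (h v)]

lemma card_orientedEdges_filter_snd {G : SimpleGraph V} {k : ℕ} (h : ∀ v, G.degree v = k)
    (S : Finset V) : ((orientedEdges G).filter fun p => p.2 ∈ S).card = S.card * k := by
  rw [← card_orientedEdges_filter_fst h S]
  refine Finset.card_equiv (Equiv.prodComm V V) fun p => ?_
  simp [orientedEdges, SimpleGraph.adj_comm]

lemma card_orientedEdges {G : SimpleGraph V} {k : ℕ} (h : ∀ v, G.degree v = k) :
    (orientedEdges G).card = Fintype.card V * k := by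
  simpa using card_orientedEdges_filter_fst h Finset.univ

/-- The oriented edges `ab` of `f i` along which an edge `xy` can be switched. -/
noncomputable def partners (F : SimpleGraph V) (f : ι → SimpleGraph V) (i : ι) (x y : V) :
    Finset (V × V) :=
  (orientedEdges (f i)).filter fun p => p.1 ∉ blocked F f x ∧ p.2 ∉ blocked F f y

lemma card_partners {d : ι → ℕ} {F : SimpleGraph V} {f : ι → SimpleGraph V} {g D : ℕ}
    (hf : IsPacking d F f) (hF : ∀ v, F.degree v ≤ g) (hD : g + ∑ i, d i = D) (i : ι) (x y : V) :
    Fintype.card V * d i ≤ (partners F f i x y).card + 2 * (D + 1) * d i := by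
  have h1 := card_orientedEdges (hf.degree i)
  have h2 := card_orientedEdges_filter_fst (hf.degree i) (blocked F f x)
  have h3 := card_orientedEdges_filter_snd (hf.degree i) (blocked F f y)
  have h4 := Nat.mul_le_mul_right (d i) (card_blocked_le hf hF hD x)
  have h5 := Nat.mul_le_mul_right (d i) (card_blocked_le hf hF hD y)
  have h6 : orientedEdges (f i) ⊆ partners F f i x y ∪
      (((orientedEdges (f i)).filter fun p => p.1 ∈ blocked F f x) ∪
        ((orientedEdges (f i)).filter fun p => p.2 ∈ blocked F f y)) := by
    intro p hp
    simp only [partners, Finset.mem_union, Finset.mem_filter, hp, true_and]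
    tauto
  have h7 := Finset.card_le_card h6
  have h8 := Finset.card_union_le (partners F f i x y)
    (((orientedEdges (f i)).filter fun p => p.1 ∈ blocked F f x) ∪
        ((orientedEdges (f i)).filter fun p => p.2 ∈ blocked F f y))
  have h9 := Finset.card_union_le ((orientedEdges (f i)).filter fun p => p.1 ∈ blocked F f x)
        ((orientedEdges (f i)).filter fun p => p.2 ∈ blocked F f y)
  linarith

lemma switchable_of_mem_partners {F : SimpleGraph V} {f : ι → SimpleGraph V} {i : ι}
    {x y : V} {p : V × V} (h : (f i).Adj x y) (hp : p ∈ partners F f i x y) :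
    Switchable F f i x y p.1 p.2 := by
  simp only [partners, Finset.mem_filter, mem_orientedEdges, mem_blocked, not_or,
    not_exists] at hp
  obtain ⟨h1, ⟨h2, h3, h4⟩, h5, h6, h7⟩ := hp
  exact ⟨h, h1, Ne.symm h2, Ne.symm h5, h3, h6, h4, h7⟩

omit [Fintype ι] in
lemma isPacking_sup_edge_iff {d : ι → ℕ} {F : SimpleGraph V} {f : ι → SimpleGraph V} {x y : V}
    (hxy : x ≠ y) : IsPacking d (F ⊔ SimpleGraph.edge x y) f ↔
      IsPacking d F f ∧ ∀ l, ¬ (f l).Adj x y := by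
  constructor
  · intro h
    refine ⟨⟨h.degree, h.color_unique, fun i u v huv hF => h.not_adj i u v huv (Or.inl hF)⟩,
      fun l hl => h.not_adj l x y hl (Or.inr ?_)⟩
    simp [SimpleGraph.edge_adj, hxy]
  · rintro ⟨h, h'⟩
    refine ⟨h.degree, h.color_unique, fun i u v huv hF => ?_⟩
    rcases hF with hF | hF
    · exact h.not_adj i u v huv hF
    · rw [SimpleGraph.edge_adj] at hF
      rcases hF.1 with ⟨rfl, rfl⟩ | ⟨rfl, rfl⟩
      · exact h' i huv
      · exact h' i huv.symm

/-- The packings avoiding `F` whose `i`-th graph contains the edge `xy`. -/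
noncomputable def packingsThrough (d : ι → ℕ) (F : SimpleGraph V) (i : ι) (x y : V) :
    Finset (ι → SimpleGraph V) :=
  (packings d F).filter fun f => (f i).Adj x y

lemma mem_packingsThrough {d : ι → ℕ} {F : SimpleGraph V} {i : ι} {x y : V}
    {f : ι → SimpleGraph V} :
    f ∈ packingsThrough d F i x y ↔ IsPacking d F f ∧ (f i).Adj x y := by
  simp [packingsThrough, mem_packings]

lemma card_packings_eq_add_sum (d : ι → ℕ) (F : SimpleGraph V) {x y : V} (hxy : x ≠ y) :
    (packings d F).card =
      (packings d (F ⊔ SimpleGraph.edge x y)).card + ∑ i, (packingsThrough d F i x y).card := by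
  rw [← Finset.card_biUnion, ← Finset.card_union_of_disjoint]
  · congr 1
    ext f
    simp only [mem_packings, Finset.mem_union, isPacking_sup_edge_iff hxy, Finset.mem_biUnion,
      Finset.mem_univ, true_and, mem_packingsThrough, exists_and_left, ← and_or_left]
    simp only [← not_exists]
    tauto
  · rw [Finset.disjoint_left]
    intro f hf hf'
    simp only [mem_packings, isPacking_sup_edge_iff hxy, Finset.mem_biUnion,
      Finset.mem_univ, true_and, mem_packingsThrough] at hf hf'
    obtain ⟨i, -, hi⟩ := hf'
    exact hf.2 i hi
  · intro i _ j _ hij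
    rw [Function.onFun_apply, Finset.disjoint_left]
    intro f hf hf'
    rw [mem_packingsThrough] at hf hf'
    exact hij (hf.1.color_unique i j x y hf.2 hf'.2)

/-- Switching the edge `xy` away. -/
lemma card_packingsThrough_mul_le {d : ι → ℕ} {F : SimpleGraph V} {g D : ℕ}
    (hF : ∀ v, F.degree v ≤ g) (hD : g + ∑ i, d i = D) (i : ι) {x y : V} (hxy : x ≠ y) :
    (packingsThrough d F i x y).card * (Fintype.card V * d i) ≤
      (packings d (F ⊔ SimpleGraph.edge x y)).card * (d i * d i) +
        (packingsThrough d F i x y).card * (2 * (D + 1) * d i) := by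
  have key : ((packingsThrough d F i x y).sigma fun f => partners F f i x y).card ≤
      ((packings d (F ⊔ SimpleGraph.edge x y)).sigma fun f =>
        (f i).neighborFinset x ×ˢ (f i).neighborFinset y).card := by
    refine Finset.card_le_card_of_injOn
      (fun q => ⟨switchAt q.1 i x y q.2.1 q.2.2, q.2⟩) ?_ ?_
    · rintro ⟨f, p⟩ hq
      simp only [Finset.coe_sigma, Set.mem_sigma_iff, Finset.mem_coe, mem_packingsThrough] at hq
      have hs := switchable_of_mem_partners hq.1.2 hq.2
      simp only [Finset.coe_sigma, Set.mem_sigma_iff, Finset.mem_coe, mem_packings,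
        isPacking_sup_edge_iff hxy, Finset.mem_product, SimpleGraph.mem_neighborFinset]
      exact ⟨⟨hs.isPacking hq.1.1, hs.switchAt_not_adj hq.1.1⟩, hs.switchAt_adj₁,
        hs.switchAt_adj₂⟩
    · rintro ⟨f, p⟩ hq ⟨f', p'⟩ hq' h
      simp only [Finset.coe_sigma, Set.mem_sigma_iff, Finset.mem_coe, mem_packingsThrough] at hq hq'
      have hs := switchable_of_mem_partners hq.1.2 hq.2
      have hs' := switchable_of_mem_partners hq'.1.2 hq'.2
      simp only [Sigma.mk.injEq, heq_eq_eq] at h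
      obtain ⟨h, rfl⟩ := h
      have : f = f' := by rw [← hs.switchAt_switchAt, h, hs'.switchAt_switchAt]
      rw [this]
  rw [Finset.card_sigma, Finset.card_sigma] at key
  have h1 : ∀ f ∈ packings d (F ⊔ SimpleGraph.edge x y),
      ((f i).neighborFinset x ×ˢ (f i).neighborFinset y).card = d i * d i := fun f hf => by
    rw [mem_packings] at hf
    rw [Finset.card_product, hf.card_neighborFinset, hf.card_neighborFinset]
  rw [Finset.sum_const_nat h1] at key
  have h2 : ∑ f ∈ packingsThrough d F i x y, Fintype.card V * d i ≤
      ∑ f ∈ packingsThrough d F i x y,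
        ((partners F f i x y).card + 2 * (D + 1) * d i) :=
    Finset.sum_le_sum fun f hf => card_partners (mem_packingsThrough.1 hf).1 hF hD i x y
  rw [Finset.sum_add_distrib, Finset.sum_const, Finset.sum_const, smul_eq_mul, smul_eq_mul] at h2
  omega

/-- The pairs of neighbours `a` of `x` and `b` of `y` for which `ab` is not available. -/
noncomputable def badPairs (F : SimpleGraph V) (f : ι → SimpleGraph V) (i : ι) (x y : V) :
    Finset (V × V) :=
  ((f i).neighborFinset x ×ˢ (f i).neighborFinset y).filter fun p => p.2 ∈ blocked F f p.1

/-- The pairs of neighbours `a` of `x` and `b` of `y` for which `ab` is available. -/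
noncomputable def goodPairs (F : SimpleGraph V) (f : ι → SimpleGraph V) (i : ι) (x y : V) :
    Finset (V × V) :=
  ((f i).neighborFinset x ×ˢ (f i).neighborFinset y).filter fun p => p.2 ∉ blocked F f p.1

/-- Switching the edge `xy` in. -/
lemma card_packings_mul_le {d : ι → ℕ} {F : SimpleGraph V}
    (i : ι) {x y : V} (hxy : x ≠ y) (hFxy : ¬ F.Adj x y) :
    (packings d (F ⊔ SimpleGraph.edge x y)).card * (d i * d i) ≤
      (packingsThrough d F i x y).card * (Fintype.card V * d i) +
        ∑ f ∈ packings d (F ⊔ SimpleGraph.edge x y),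
          (badPairs (F ⊔ SimpleGraph.edge x y) f i x y).card := by
  set F' := F ⊔ SimpleGraph.edge x y with hF'
  have sw : ∀ f ∈ packings d F', ∀ p ∈ goodPairs F' f i x y, Switchable F f i x p.1 y p.2 := by
    intro f hf p hp
    simp only [goodPairs, Finset.mem_filter, Finset.mem_product, SimpleGraph.mem_neighborFinset,
      mem_blocked, not_or, not_exists] at hp
    rw [mem_packings, isPacking_sup_edge_iff hxy] at hf
    exact ⟨hp.1.1, hp.1.2, hxy, Ne.symm hp.2.1, hFxy, fun h => hp.2.2.1 (Or.inl h), hf.2,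
      hp.2.2.2⟩
  have key : ((packings d F').sigma fun f => goodPairs F' f i x y).card ≤
      ((packingsThrough d F i x y).sigma fun f => orientedEdges (f i)).card := by
    refine Finset.card_le_card_of_injOn
      (fun q => ⟨switchAt q.1 i x q.2.1 y q.2.2, q.2⟩) ?_ ?_
    · rintro ⟨f, p⟩ hq
      simp only [Finset.coe_sigma, Set.mem_sigma_iff, Finset.mem_coe] at hq
      have hs := sw f hq.1 p hq.2
      rw [mem_packings, isPacking_sup_edge_iff hxy] at hq
      simp only [Finset.coe_sigma, Set.mem_sigma_iff, Finset.mem_coe, mem_packingsThrough,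
        mem_orientedEdges]
      exact ⟨⟨hs.isPacking hq.1.1, hs.switchAt_adj₁⟩, hs.switchAt_adj₂⟩
    · rintro ⟨f, p⟩ hq ⟨f', p'⟩ hq' h
      simp only [Finset.coe_sigma, Set.mem_sigma_iff, Finset.mem_coe] at hq hq'
      have hs := sw f hq.1 p hq.2
      have hs' := sw f' hq'.1 p' hq'.2
      simp only [Sigma.mk.injEq, heq_eq_eq] at h
      obtain ⟨h, rfl⟩ := h
      have : f = f' := by rw [← hs.switchAt_switchAt, h, hs'.switchAt_switchAt]
      rw [this]
  rw [Finset.card_sigma, Finset.card_sigma] at key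
  have h1 : ∀ f ∈ packingsThrough d F i x y,
      (orientedEdges (f i)).card = Fintype.card V * d i := fun f hf =>
    card_orientedEdges ((mem_packingsThrough.1 hf).1.degree i)
  rw [Finset.sum_const_nat h1] at key
  have h2 : ∀ f ∈ packings d F',
      (badPairs F' f i x y).card + (goodPairs F' f i x y).card = d i * d i := fun f hf => by
    rw [mem_packings] at hf
    rw [badPairs, goodPairs, Finset.card_filter_add_card_filter_not, Finset.card_product,
      hf.card_neighborFinset, hf.card_neighborFinset]
  rw [← Finset.sum_const_nat h2, Finset.sum_add_distrib]
  omega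

/-- Oriented edges `uv` along which the edge `yb` can be switched without removing `xa`
or `ab`. -/
noncomputable def freePartners (F : SimpleGraph V) (f : ι → SimpleGraph V) (i : ι) (x y a b : V) :
    Finset (V × V) :=
  partners F f i y b \ {(x, a), (a, x), (a, b), (b, a)}

lemma card_freePartners {d : ι → ℕ} {F : SimpleGraph V} {f : ι → SimpleGraph V} {g D : ℕ}
    (hf : IsPacking d F f) (hF : ∀ v, F.degree v ≤ g) (hD : g + ∑ i, d i = D) (i : ι)
    (x y a b : V) :
    Fintype.card V * d i ≤ (freePartners F f i x y a b).card + (2 * (D + 1) * d i + 4) := by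
  have h1 := card_partners hf hF hD i y b
  have h2 := Finset.le_card_sdiff {(x, a), (a, x), (a, b), (b, a)} (partners F f i y b)
  have h3 : ({(x, a), (a, x), (a, b), (b, a)} : Finset (V × V)).card ≤ 4 := Finset.card_le_four
  unfold freePartners
  omega

/-- Bad pairs are rare on average. -/
lemma sum_card_badPairs_mul_le {d : ι → ℕ} {F : SimpleGraph V} {g D : ℕ}
    (hF : ∀ v, F.degree v ≤ g) (hD : g + ∑ i, d i = D) (i : ι) {x y : V} (hxy : F.Adj x y) :
    (∑ f ∈ packings d F, (badPairs F f i x y).card) * (Fintype.card V * d i) ≤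
      (packings d F).card * (d i * d i * ((D + 1) * d i)) +
        (∑ f ∈ packings d F, (badPairs F f i x y).card) * (2 * (D + 1) * d i + 4) := by
  have sw : ∀ f ∈ packings d F, ∀ p ∈ badPairs F f i x y,
      ∀ q ∈ freePartners F f i x y p.1 p.2, Switchable F f i y p.2 q.1 q.2 := by
    intro f hf p hp q hq
    simp only [badPairs, Finset.mem_filter, Finset.mem_product,
      SimpleGraph.mem_neighborFinset] at hp
    exact switchable_of_mem_partners hp.1.2 (Finset.mem_sdiff.1 hq).1
  have key : ((packings d F).sigma fun f => (badPairs F f i x y).sigma fun p =>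
        freePartners F f i x y p.1 p.2).card ≤
      ((packings d F).sigma fun f => ((f i).neighborFinset x ×ˢ (f i).neighborFinset y).sigma
        fun q => (blocked F f q.1).sigma fun b => (f i).neighborFinset b).card := by
    refine Finset.card_le_card_of_injOn
      (fun t => ⟨switchAt t.1 i y t.2.1.2 t.2.2.1 t.2.2.2,
        ⟨(t.2.1.1, t.2.2.1), ⟨t.2.1.2, t.2.2.2⟩⟩⟩) ?_ ?_
    · rintro ⟨f, ⟨a, b⟩, ⟨u, v⟩⟩ ht
      simp only [Finset.mem_coe, Finset.mem_sigma] at ht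
      obtain ⟨hf, hp, hq⟩ := ht
      have hs := sw f hf _ hp _ hq
      rw [mem_packings] at hf
      simp only [Finset.mem_coe, Finset.mem_sigma, mem_packings, Finset.mem_product,
        SimpleGraph.mem_neighborFinset, mem_blocked]
      simp only [badPairs, Finset.mem_filter, Finset.mem_product,
        SimpleGraph.mem_neighborFinset, mem_blocked] at hp
      simp only [freePartners, Finset.mem_sdiff, Finset.mem_insert, Finset.mem_singleton,
        Prod.mk.injEq, not_or] at hq
      obtain ⟨-, q1, q2, q3, q4⟩ := hq
      have hne : x ≠ y := hxy.ne
      have hay : a ≠ y := by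
        rintro rfl
        exact hf.not_adj i _ _ hp.1.1 hxy
      refine ⟨hs.isPacking hf, ⟨?_, hs.switchAt_adj₁⟩, ?_, hs.switchAt_adj₂⟩
      · rw [switchAt_adj]
        refine Or.inl ⟨hp.1.1, fun _ => ?_⟩
        simp only [Sym2.eq_iff, ne_eq]
        grind
      · refine hp.2.imp_right (Or.imp_right ?_)
        rintro ⟨l, hl⟩
        refine ⟨l, ?_⟩
        rw [switchAt_adj]
        refine Or.inl ⟨hl, fun _ => ?_⟩
        simp only [Sym2.eq_iff, ne_eq]
        grind
    · rintro ⟨f, ⟨a, b⟩, ⟨u, v⟩⟩ ht ⟨f', ⟨a', b'⟩, ⟨u', v'⟩⟩ ht' h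
      simp only [Finset.mem_coe, Finset.mem_sigma] at ht ht'
      have hs := sw f ht.1 _ ht.2.1 _ ht.2.2
      have hs' := sw f' ht'.1 _ ht'.2.1 _ ht'.2.2
      simp only [Sigma.mk.injEq, heq_eq_eq, Prod.mk.injEq] at h hs hs'
      obtain ⟨h, ⟨rfl, rfl⟩, rfl, rfl⟩ := h
      have : f = f' := by rw [← hs.switchAt_switchAt, h, hs'.switchAt_switchAt]
      rw [this]
  rw [Finset.card_sigma, Finset.card_sigma] at key
  have h1 : ∑ f ∈ packings d F, (((f i).neighborFinset x ×ˢ (f i).neighborFinset y).sigma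
      fun q => (blocked F f q.1).sigma fun b => (f i).neighborFinset b).card ≤
      (packings d F).card * (d i * d i * ((D + 1) * d i)) := by
    refine Finset.sum_le_card_nsmul _ _ _ fun f hf => ?_
    rw [mem_packings] at hf
    rw [Finset.card_sigma]
    refine (Finset.sum_le_card_nsmul _ _ ((D + 1) * d i) fun q _ => ?_).trans ?_
    · rw [Finset.card_sigma, Finset.sum_const_nat fun b _ => hf.card_neighborFinset i b]
      exact Nat.mul_le_mul_right _ (card_blocked_le hf hF hD _)
    · rw [Finset.card_product, hf.card_neighborFinset, hf.card_neighborFinset, smul_eq_mul]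
  have h2 : (∑ f ∈ packings d F, (badPairs F f i x y).card) * (Fintype.card V * d i) ≤
      ∑ f ∈ packings d F, ((badPairs F f i x y).sigma fun p =>
        freePartners F f i x y p.1 p.2).card +
        (∑ f ∈ packings d F, (badPairs F f i x y).card) * (2 * (D + 1) * d i + 4) := by
    rw [Finset.sum_mul, Finset.sum_mul, ← Finset.sum_add_distrib]
    refine Finset.sum_le_sum fun f hf => ?_
    rw [Finset.card_sigma, ← smul_eq_mul, ← smul_eq_mul (a := (badPairs F f i x y).card),
      ← Finset.sum_const, ← Finset.sum_const, ← Finset.sum_add_distrib]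
    exact Finset.sum_le_sum fun p _ =>
      card_freePartners (mem_packings.1 hf) hF hD i x y p.1 p.2
  omega

lemma card_packings_le_mul_sup_edge {d : ι → ℕ} {F : SimpleGraph V} {g D : ℕ}
    (hF : ∀ v, F.degree v ≤ g) (hd : ∀ i, 1 ≤ d i) (hD : g + ∑ i, d i = D)
    (hn : 2 * D + 2 < Fintype.card V) {x y : V} (hxy : x ≠ y) :
    ((packings d F).card : ℝ) ≤
      (1 + (∑ i, (d i : ℝ)) / (Fintype.card V - 2 * D - 2)) *
        (packings d (F ⊔ SimpleGraph.edge x y)).card := by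
  have hn' : (0 : ℝ) < Fintype.card V - 2 * D - 2 := by
    have : (2 * D + 2 : ℝ) < Fintype.card V := by exact_mod_cast hn
    linarith
  rw [card_packings_eq_add_sum d F hxy]
  push_cast
  rw [add_mul, one_mul, add_le_add_iff_left, div_mul_eq_mul_div, le_div_iff₀ hn', Finset.sum_mul,
    Finset.sum_mul]
  refine Finset.sum_le_sum fun i _ => ?_
  have h : ((packingsThrough d F i x y).card : ℝ) * (Fintype.card V * d i) ≤
      (packings d (F ⊔ SimpleGraph.edge x y)).card * (d i * d i) +
        (packingsThrough d F i x y).card * (2 * (D + 1) * d i) := by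
    exact_mod_cast card_packingsThrough_mul_le hF hD i hxy
  have hi : (0 : ℝ) < d i := by exact_mod_cast hd i
  refine le_of_mul_le_mul_right ?_ hi
  linarith

lemma edge_density_aux {P B T N k D : ℝ} (hk : 1 ≤ k) (hD : 2 ≤ D) (hN : 10 * D < N)
    (hP : 0 ≤ P) (hB : 0 ≤ B) (h₁ : P * (k * k) ≤ T * (N * k) + B)
    (h₂ : B * (N * k) ≤ P * (k * k * ((D + 1) * k)) + B * (2 * (D + 1) * k + 4)) :
    k / N * (1 - 10 * D / N) * P ≤ T := by
  have hN0 : 0 < N := by linarith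
  have hk0 : 0 < k := by linarith
  have e1 : 2 * (D + 1) * k + 4 ≤ N * k / 2 := by nlinarith
  have e2 : B * (2 * (D + 1) * k + 4) ≤ B * (N * k / 2) := mul_le_mul_of_nonneg_left e1 hB
  have e3 : P * (k * k * ((D + 1) * k)) ≤ P * (k * k * (2 * D * k)) := by
    gcongr
    linarith
  have e4 : B * N ≤ 4 * P * k * k * D := by
    refine le_of_mul_le_mul_right ?_ hk0
    linarith
  have e5 : k * (N - 10 * D) * P ≤ T * (N * N) := by
    refine le_of_mul_le_mul_right ?_ hk0
    have := mul_le_mul_of_nonneg_right h₁ hN0.le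
    have : 0 ≤ P * k * k * D := by positivity
    linarith
  have e6 : k / N * (1 - 10 * D / N) * P = k * (N - 10 * D) * P / (N * N) := by
    field_simp
  rw [e6, div_le_iff₀ (by positivity)]
  exact e5

lemma mul_card_packings_sup_edge_le {d : ι → ℕ} {F F' : SimpleGraph V} {g D : ℕ} {x y : V}
    (hF : F' = F ⊔ SimpleGraph.edge x y) (hdeg : ∀ v, F'.degree v ≤ g) (hd : ∀ i, 1 ≤ d i)
    (hD : g + ∑ i, d i = D) (hD2 : 2 ≤ D) (hxy : x ≠ y) (hFxy : ¬ F.Adj x y) :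
    (1 + max 0 ((∑ i, (d i : ℝ)) / Fintype.card V * (1 - 10 * D / Fintype.card V))) *
        (packings d F').card ≤ ((packings d F).card : ℝ) := by
  have : Nonempty V := ⟨x⟩
  have hV : (0 : ℝ) < Fintype.card V := by exact_mod_cast Fintype.card_pos
  have hD2' : (2 : ℝ) ≤ D := by exact_mod_cast hD2
  rw [card_packings_eq_add_sum d F hxy, ← hF]
  push_cast
  rw [add_mul, one_mul, add_le_add_iff_left]
  rcases le_or_gt (Fintype.card V : ℝ) (10 * D) with hn | hn
  · rw [max_eq_left, zero_mul]
    · positivity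
    · refine mul_nonpos_of_nonneg_of_nonpos (by positivity) ?_
      rw [sub_nonpos, le_div_iff₀ hV]
      linarith
  rw [max_eq_right, Finset.sum_div, Finset.sum_mul, Finset.sum_mul]
  swap
  · refine mul_nonneg (by positivity) ?_
    rw [sub_nonneg, div_le_one hV]
    exact hn.le
  refine Finset.sum_le_sum fun i _ => ?_
  have h1 : ((packings d F').card : ℝ) * (d i * d i) ≤
      (packingsThrough d F i x y).card * (Fintype.card V * d i) +
        (∑ f ∈ packings d F', (badPairs F' f i x y).card : ℕ) := by
    rw [hF]
    exact_mod_cast card_packings_mul_le i hxy hFxy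
  have h2 : ((∑ f ∈ packings d F', (badPairs F' f i x y).card : ℕ) : ℝ) *
      (Fintype.card V * d i) ≤ (packings d F').card * (d i * d i * ((D + 1) * d i)) +
        (∑ f ∈ packings d F', (badPairs F' f i x y).card : ℕ) * (2 * (D + 1) * d i + 4) := by
    exact_mod_cast sum_card_badPairs_mul_le hdeg hD i
      (by rw [hF]; exact Or.inr (by simp [SimpleGraph.edge_adj, hxy]))
  have hi : (1 : ℝ) ≤ d i := by exact_mod_cast hd i
  have hP : (0 : ℝ) ≤ (packings d F').card := Nat.cast_nonneg _
  have hB : (0 : ℝ) ≤ (∑ f ∈ packings d F', (badPairs F' f i x y).card : ℕ) := Nat.cast_nonneg _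
  generalize ((∑ f ∈ packings d F', (badPairs F' f i x y).card : ℕ) : ℝ) = B at h1 h2 hB
  generalize ((packings d F').card : ℝ) = P at h1 h2 hP ⊢
  generalize ((packingsThrough d F i x y).card : ℝ) = T at h1 ⊢
  generalize (Fintype.card V : ℝ) = N at hV hn h1 h2 ⊢
  generalize (d i : ℝ) = k at hi h1 h2 ⊢
  generalize (D : ℝ) = D at hD2' hn h2 ⊢
  exact edge_density_aux hi hD2' hn hP hB h1 h2

lemma degree_le_of_subgraph {H G : SimpleGraph V} {k : ℕ} (h : H ≤ G) (hG : ∀ v, G.degree v ≤ k)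
    (v : V) : H.degree v ≤ k := by
  refine le_trans ?_ (hG v)
  rw [← SimpleGraph.card_neighborFinset_eq_degree, ← SimpleGraph.card_neighborFinset_eq_degree]
  refine Finset.card_le_card fun w hw => ?_
  rw [SimpleGraph.mem_neighborFinset] at hw ⊢
  exact h hw

lemma card_packings_chain {d : ι → ℕ} {G : SimpleGraph V} {g D : ℕ}
    (hG : ∀ v, G.degree v ≤ g) (hd : ∀ i, 1 ≤ d i) (hD : g + ∑ i, d i = D) (hD2 : 2 ≤ D)
    (hn : 2 * D + 2 < Fintype.card V) (s : Finset (Sym2 V)) (hs : (s : Set (Sym2 V)) ⊆ G.edgeSet) :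
    ((packings d (⊥ : SimpleGraph V)).card : ℝ) ≤
        (1 + (∑ i, (d i : ℝ)) / (Fintype.card V - 2 * D - 2)) ^ s.card *
          (packings d (SimpleGraph.fromEdgeSet (s : Set (Sym2 V)))).card ∧
      (1 + max 0 ((∑ i, (d i : ℝ)) / Fintype.card V * (1 - 10 * D / Fintype.card V))) ^ s.card *
          (packings d (SimpleGraph.fromEdgeSet (s : Set (Sym2 V)))).card ≤
        ((packings d (⊥ : SimpleGraph V)).card : ℝ) := by
  have hn' : (0 : ℝ) < Fintype.card V - 2 * D - 2 := by
    have : (2 * D + 2 : ℝ) < Fintype.card V := by exact_mod_cast hn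
    linarith
  induction s using Finset.induction_on with
  | empty => simp
  | insert e s he ih =>
    rw [Finset.coe_insert, Set.insert_subset_iff] at hs
    obtain ⟨ih1, ih2⟩ := ih hs.2
    induction e with
    | h x y =>
    have hxy : x ≠ y := G.ne_of_adj hs.1
    have hins : SimpleGraph.fromEdgeSet ((insert s(x, y) s : Finset (Sym2 V)) : Set (Sym2 V)) =
        SimpleGraph.fromEdgeSet (s : Set (Sym2 V)) ⊔ SimpleGraph.edge x y := by
      rw [SimpleGraph.edge, ← SimpleGraph.fromEdgeSet_union, Finset.coe_insert, Set.union_singleton]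
    have hle : SimpleGraph.fromEdgeSet (s : Set (Sym2 V)) ⊔ SimpleGraph.edge x y ≤ G := by
      rw [← hins, ← SimpleGraph.fromEdgeSet_edgeSet G]
      refine SimpleGraph.fromEdgeSet_mono ?_
      rw [Finset.coe_insert, Set.insert_subset_iff]
      exact hs
    have hnadj : ¬ (SimpleGraph.fromEdgeSet (s : Set (Sym2 V))).Adj x y := by
      simp [SimpleGraph.fromEdgeSet_adj, he]
    have h1 := card_packings_le_mul_sup_edge
      (degree_le_of_subgraph (le_sup_left.trans hle) hG) hd hD hn hxy
    obtain ⟨F', hF'⟩ : ∃ F', F' = SimpleGraph.fromEdgeSet (s : Set (Sym2 V)) ⊔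
        SimpleGraph.edge x y := ⟨_, rfl⟩
    rw [← hF'] at hle h1 hins
    have h2 := mul_card_packings_sup_edge_le hF'
      (degree_le_of_subgraph hle hG) hd hD hD2 hxy hnadj
    rw [hins, Finset.card_insert_of_notMem he, pow_succ, pow_succ, mul_assoc, mul_assoc]
    exact ⟨ih1.trans (mul_le_mul_of_nonneg_left h1 (by positivity)),
      (mul_le_mul_of_nonneg_left h2 (by positivity)).trans ih2⟩

lemma pow_ratio_bound {n g h D E : ℕ} (hE : 2 * E = n * g) (hD : g + h = D) (hD2 : 2 ≤ D)
    (hn : D ^ 3 ≤ n) :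
    (1 + (h : ℝ) / (n - 2 * D - 2)) ^ E ≤
      Real.exp 11 * (1 + max 0 ((h : ℝ) / n * (1 - 10 * D / n))) ^ E := by
  have hhD : (g : ℝ) + h = D := by exact_mod_cast hD
  have hE' : 2 * (E : ℝ) = n * g := by exact_mod_cast hE
  have hn' : (D : ℝ) ^ 3 ≤ n := by exact_mod_cast hn
  have hD2' : (2 : ℝ) ≤ D := by exact_mod_cast hD2
  have hg : (0 : ℝ) ≤ g := Nat.cast_nonneg _
  have hh : (0 : ℝ) ≤ h := Nat.cast_nonneg _
  generalize (g : ℝ) = g at *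
  generalize (h : ℝ) = h at *
  generalize (n : ℝ) = n at *
  generalize (D : ℝ) = D at *
  have hn4 : 4 * D ≤ n := by nlinarith [mul_nonneg (sub_nonneg.2 hD2') (sub_nonneg.2 hD2')]
  have hn0 : 0 < n := by linarith
  have hn1 : n / 4 ≤ n - 2 * D - 2 := by linarith
  have hn2 : 0 < n - 2 * D - 2 := by linarith
  have hδ : h / (n - 2 * D - 2) ≤ h / n * (1 - 10 * D / n) + 22 * h * D / n ^ 2 := by
    have e1 : h / n * (1 - 10 * D / n) + 22 * h * D / n ^ 2 = h * (n + 12 * D) / n ^ 2 := by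
      field_simp
      ring
    rw [e1, div_le_div_iff₀ hn2 (by positivity), mul_assoc]
    refine mul_le_mul_of_nonneg_left ?_ hh
    nlinarith
  have hr : 0 ≤ max 0 (h / n * (1 - 10 * D / n)) := le_max_left _ _
  have hr' := le_max_right 0 (h / n * (1 - 10 * D / n))
  generalize max 0 (h / n * (1 - 10 * D / n)) = r at *
  have hδ0 : 0 ≤ 22 * h * D / n ^ 2 := by positivity
  have step : 1 + h / (n - 2 * D - 2) ≤ Real.exp (22 * h * D / n ^ 2) * (1 + r) := by
    have := Real.add_one_le_exp (22 * h * D / n ^ 2)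
    nlinarith
  have hexp : E * (22 * h * D / n ^ 2) ≤ 11 := by
    have e2 : E * (22 * h * D / n ^ 2) = 11 * (g * h * D) / n := by
      have : (E : ℝ) = n * g / 2 := by linarith
      rw [this]
      field_simp
      ring
    have e3 : g * h * D ≤ D ^ 3 := by
      have : g * h ≤ D * D := mul_le_mul (by linarith) (by linarith) hh (by linarith)
      nlinarith
    rw [e2, div_le_iff₀ hn0]
    linarith
  calc (1 + h / (n - 2 * D - 2)) ^ E ≤ (Real.exp (22 * h * D / n ^ 2) * (1 + r)) ^ E :=
        pow_le_pow_left₀ (by positivity) step E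
    _ = Real.exp (E * (22 * h * D / n ^ 2)) * (1 + r) ^ E := by
        rw [mul_pow, ← Real.exp_nat_mul]
    _ ≤ Real.exp 11 * (1 + r) ^ E := by
        gcongr

/-- The number of packings avoiding a `g`-regular graph depends on this graph only up to a
bounded factor. -/
lemma card_packings_le_exp_mul {d : ι → ℕ} {G G' : SimpleGraph V} {g D : ℕ}
    (hG : ∀ v, G.degree v = g) (hG' : ∀ v, G'.degree v = g) (hd : ∀ i, 1 ≤ d i)
    (hD : g + ∑ i, d i = D) (hD2 : 2 ≤ D) (hn : D ^ 3 ≤ Fintype.card V) :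
    ((packings d G).card : ℝ) ≤ Real.exp 11 * (packings d G').card := by
  have hn2 : 2 * D + 2 < Fintype.card V := by nlinarith [mul_le_mul hD2 hD2 zero_le_two (by omega)]
  have hE : 2 * G.edgeFinset.card = Fintype.card V * g := by
    rw [← G.sum_degrees_eq_twice_card_edges, Finset.sum_const_nat fun v _ => hG v,
      Finset.card_univ]
  have hE' : 2 * G'.edgeFinset.card = Fintype.card V * g := by
    rw [← G'.sum_degrees_eq_twice_card_edges, Finset.sum_const_nat fun v _ => hG' v,
      Finset.card_univ]
  have hEE : G'.edgeFinset.card = G.edgeFinset.card := by omega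
  have h1 := (card_packings_chain (fun v => (hG v).le) hd hD hD2 hn2 G.edgeFinset (by simp)).2
  have h2 := (card_packings_chain (fun v => (hG' v).le) hd hD hD2 hn2 G'.edgeFinset (by simp)).1
  rw [SimpleGraph.coe_edgeFinset, SimpleGraph.fromEdgeSet_edgeSet] at h1 h2
  rw [hEE] at h2
  have h3 := pow_ratio_bound hE hD hD2 hn
  push_cast at h3
  have hA : 0 < (1 + max 0 ((∑ i, (d i : ℝ)) / Fintype.card V *
      (1 - 10 * D / Fintype.card V))) ^ G.edgeFinset.card :=
    pow_pos (add_pos_of_pos_of_nonneg one_pos (le_max_left _ _)) _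
  refine le_of_mul_le_mul_left ?_ hA
  calc _ ≤ _ := h1.trans h2
    _ ≤ _ := mul_le_mul_of_nonneg_right h3 (Nat.cast_nonneg _)
    _ = _ := by ring

/-- Reweighting two probability vectors by a kernel whose total masses are comparable on their
supports, and renormalising, increases their distance by a bounded factor. -/
lemma sum_abs_normalized_sub_le {α β : Type*} [Fintype α] [Fintype β] {q : α → β → ℝ}
    (hq : ∀ a b, 0 ≤ q a b) {K : ℝ} (hK : 0 ≤ K) {P : α → Prop}
    (hw : ∀ a a', P a → P a' → ∑ b, q a b ≤ K * ∑ b, q a' b) {η η' : α → ℝ}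
    (hη : ∀ a, 0 ≤ η a) (hη1 : ∑ a, η a = 1) (hη' : ∀ a, 0 ≤ η' a) (hη1' : ∑ a, η' a = 1)
    (hP : ∀ a, η a ≠ 0 → P a) (hP' : ∀ a, η' a ≠ 0 → P a) :
    ∑ b, |(∑ a, η a * q a b) / (∑ b, ∑ a, η a * q a b) -
        (∑ a, η' a * q a b) / (∑ b, ∑ a, η' a * q a b)| ≤ 2 * K * ∑ a, |η a - η' a| := by
  set w : α → ℝ := fun a => ∑ b, q a b with hwdef
  have hw0 : ∀ a, 0 ≤ w a := fun a => Finset.sum_nonneg fun b _ => hq a b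
  have hA : ∀ θ : α → ℝ, ∑ b, ∑ a, θ a * q a b = ∑ a, θ a * w a := fun θ => by
    rw [Finset.sum_comm]
    simp only [hwdef, Finset.mul_sum]
  have hle : ∀ θ : α → ℝ, (∀ a, 0 ≤ θ a) → ∑ a, θ a = 1 → (∀ a, θ a ≠ 0 → P a) →
      ∀ a, P a → w a ≤ K * ∑ a, θ a * w a := by
    intro θ h0 h1 hs a ha
    calc w a = ∑ a', θ a' * w a := by rw [← Finset.sum_mul, h1, one_mul]
      _ ≤ ∑ a', θ a' * (K * w a') := by
          refine Finset.sum_le_sum fun a' _ => ?_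
          by_cases h : θ a' = 0
          · simp [h]
          · exact mul_le_mul_of_nonneg_left (hw a a' ha (hs a' h)) (h0 a')
      _ = K * ∑ a', θ a' * w a' := by
          rw [Finset.mul_sum]
          exact Finset.sum_congr rfl fun _ _ => by ring
  rw [hA, hA]
  set A := ∑ a, η a * w a with hAdef
  set A' := ∑ a, η' a * w a with hAdef'
  have hA0 : 0 ≤ A := Finset.sum_nonneg fun a _ => mul_nonneg (hη a) (hw0 a)
  have hA0' : 0 ≤ A' := Finset.sum_nonneg fun a _ => mul_nonneg (hη' a) (hw0 a)
  have hle1 := hle η hη hη1 hP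
  have hle2 := hle η' hη' hη1' hP'
  have hS : 0 ≤ ∑ a, |η a - η' a| := Finset.sum_nonneg fun a _ => abs_nonneg _
  have hdiff : ∀ a, |η a - η' a| * w a ≤ |η a - η' a| * (K * A) := fun a => by
    by_cases h : P a
    · exact mul_le_mul_of_nonneg_left (hle1 a h) (abs_nonneg _)
    · have h1 : η a = 0 := by_contra fun h' => h (hP a h')
      have h2 : η' a = 0 := by_contra fun h' => h (hP' a h')
      simp [h1, h2]
  have hzero : ∀ {θ : α → ℝ} {B : ℝ}, (∀ a, θ a ≠ 0 → P a) → (∀ a, P a → w a ≤ K * B) → B = 0 →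
      ∑ a, θ a * w a = 0 := by
    intro θ B hs hB hB0
    refine Finset.sum_eq_zero fun a _ => ?_
    by_cases h : θ a = 0
    · simp [h]
    · have := hB a (hs a h)
      rw [hB0, mul_zero] at this
      rw [le_antisymm this (hw0 a), mul_zero]
  by_cases hAz : A = 0
  · have : A' = 0 := hzero hP' hle1 hAz
    simp only [hAz, this, div_zero, sub_zero, abs_zero, Finset.sum_const_zero]
    positivity
  have hAz' : A' ≠ 0 := fun h => hAz (hzero hP hle2 h)
  have hApos : 0 < A := lt_of_le_of_ne hA0 (Ne.symm hAz)
  have hApos' : 0 < A' := lt_of_le_of_ne hA0' (Ne.symm hAz')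
  have hT : ∑ a, |η a - η' a| * w a ≤ (∑ a, |η a - η' a|) * (K * A) := by
    rw [Finset.sum_mul]
    exact Finset.sum_le_sum fun a _ => hdiff a
  have hAA : |A' - A| ≤ ∑ a, |η a - η' a| * w a := by
    rw [hAdef, hAdef', ← Finset.sum_sub_distrib]
    refine (Finset.abs_sum_le_sum_abs _ _).trans (Finset.sum_le_sum fun a _ => ?_)
    rw [← sub_mul, abs_mul, abs_of_nonneg (hw0 a), abs_sub_comm]
  calc _ ≤ ∑ b, ∑ a, (|η a - η' a| * q a b / A + η' a * q a b * (|A' - A| / (A * A'))) := by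
        refine Finset.sum_le_sum fun b _ => ?_
        rw [Finset.sum_div, Finset.sum_div, ← Finset.sum_sub_distrib]
        refine (Finset.abs_sum_le_sum_abs _ _).trans (Finset.sum_le_sum fun a _ => ?_)
        have : η a * q a b / A - η' a * q a b / A' =
            (η a - η' a) * q a b / A + η' a * q a b * ((A' - A) / (A * A')) := by
          field_simp
          ring
        rw [this]
        refine (abs_add_le _ _).trans_eq ?_
        rw [abs_div, abs_mul, abs_mul, abs_mul, abs_div, abs_of_nonneg (hq a b),
          abs_of_pos hApos, abs_of_nonneg (hη' a), abs_of_pos (mul_pos hApos hApos')]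
    _ = (∑ a, |η a - η' a| * w a) / A + A' * (|A' - A| / (A * A')) := by
        simp only [Finset.sum_add_distrib]
        rw [← hA, hAdef', ← hA]
        simp only [Finset.sum_div, Finset.sum_mul]
    _ = (∑ a, |η a - η' a| * w a) / A + |A' - A| / A := by
        congr 1
        field_simp
    _ ≤ (∑ a, |η a - η' a|) * (K * A) / A + (∑ a, |η a - η' a|) * (K * A) / A := by
        gcongr
        exact hAA.trans hT
    _ = 2 * K * ∑ a, |η a - η' a| := by
        field_simp
        ring

lemma gDeg_eq_degree {n : ℕ} (G : SimpleGraph (Fin n)) (v : Fin n) : gDeg G v = G.degree v := by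
  rw [← SimpleGraph.card_neighborFinset_eq_degree, gDeg, Nat.card_eq_fintype_card,
    Fintype.card_subtype]
  congr 1
  ext w
  simp

lemma isPacking_iff {n m : ℕ} {d : Fin m → ℕ} {F : SimpleGraph (Fin n)}
    {f : Fin m → SimpleGraph (Fin n)} :
    IsPacking d F f ↔ ((∀ i j, i ≠ j → Disjoint (f i) (f j)) ∧ Disjoint F (⨆ i, f i)) ∧
      ∀ i, IsRegularGraph (f i) (d i) := by
  simp only [disjoint_iSup_iff, SimpleGraph.disjoint_left, IsRegularGraph, gDeg_eq_degree]
  constructor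
  · intro h
    exact ⟨⟨fun i j hij u v hu hv => hij (h.color_unique i j u v hu hv),
      fun i u v hF hu => h.not_adj i u v hu hF⟩, h.degree⟩
  · rintro ⟨⟨h1, h2⟩, h3⟩
    exact ⟨h3, fun i j u v hu hv => by_contra fun hij => h1 i j hij _ _ hu hv,
      fun i u v hu hF => h2 i _ _ hF hu⟩

lemma prod_mu {n m : ℕ} (d : Fin m → ℕ) (f : Fin m → SimpleGraph (Fin n)) :
    ∏ i, mu n (d i) (f i) = if ∀ i, IsRegularGraph (f i) (d i) then
      ∏ i, (Nat.card {H : SimpleGraph (Fin n) // IsRegularGraph H (d i)} : ℝ)⁻¹ else 0 := by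
  split_ifs with h
  · exact Finset.prod_congr rfl fun i _ => if_pos (h i)
  · obtain ⟨i, hi⟩ := not_forall.1 h
    exact Finset.prod_eq_zero (Finset.mem_univ i) (if_neg hi)

/-- The mass that `⊕ᵢ μ_{dᵢ,n}` gives to the graphs disjoint from `F` is proportional to the number
of packings avoiding `F`. -/
lemma exists_sum_oplusFold_eq {n m : ℕ} (d : Fin m → ℕ) : ∃ c : ℝ, 0 ≤ c ∧
    ∀ F : SimpleGraph (Fin n),
      ∑ H, (if Disjoint F H then oplusFold m (fun i => mu n (d i)) H else 0) =
        c * (packings d F).card := by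
  set c := ∏ i, (Nat.card {H : SimpleGraph (Fin n) // IsRegularGraph H (d i)} : ℝ)⁻¹ with hc
  have hc0 : 0 ≤ c := Finset.prod_nonneg fun i _ => by positivity
  have hmass : ∀ H, 0 ≤ oplusFoldMass m (fun i => mu n (d i)) H := fun H => by
    refine tsum_nonneg fun f => ?_
    rw [prod_mu]
    split_ifs <;> first | exact hc0 | exact le_rfl
  refine ⟨c / ∑' H : SimpleGraph (Fin n), oplusFoldMass m (fun i => mu n (d i)) H,
    div_nonneg hc0 (tsum_nonneg hmass), fun F => ?_⟩
  have hdiv : ∀ H, (if Disjoint F H then oplusFold m (fun i => mu n (d i)) H else 0) =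
      (if Disjoint F H then oplusFoldMass m (fun i => mu n (d i)) H else 0) /
        ∑' H, oplusFoldMass m (fun i => mu n (d i)) H := fun H => by
    split_ifs
    · rfl
    · rw [zero_div]
  have hterm : ∀ f : Fin m → SimpleGraph (Fin n),
      ∑ H, (if Disjoint F H then if (∀ i j, i ≠ j → Disjoint (f i) (f j)) ∧ (⨆ i, f i) = H then
        ∏ i, mu n (d i) (f i) else 0 else 0) = if IsPacking d F f then c else 0 := fun f => by
    rw [Finset.sum_eq_single (⨆ i, f i), prod_mu, isPacking_iff]
    · split_ifs <;> tauto
    · intro H _ hH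
      simp only [hH.symm, and_false, if_false, ite_self]
    · exact fun h => absurd (Finset.mem_univ _) h
  have hsum : ∑ H, (if Disjoint F H then oplusFoldMass m (fun i => mu n (d i)) H else 0) =
      c * (packings d F).card := by
    calc _ = ∑ H, ∑ f : Fin m → SimpleGraph (Fin n), (if Disjoint F H then
          if (∀ i j, i ≠ j → Disjoint (f i) (f j)) ∧ (⨆ i, f i) = H then
            ∏ i, mu n (d i) (f i) else 0 else 0) := by
          refine Finset.sum_congr rfl fun H _ => ?_
          rw [oplusFoldMass, tsum_fintype]
          split_ifs
          · rfl
          · rw [Finset.sum_const_zero]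
      _ = ∑ f : Fin m → SimpleGraph (Fin n), if IsPacking d F f then c else 0 := by
          rw [Finset.sum_comm]
          exact Finset.sum_congr rfl fun f _ => hterm f
      _ = c * (packings d F).card := by
          have hfilter : Finset.univ.filter (fun f => IsPacking d F f) = packings d F :=
            Finset.ext fun f => by rw [mem_packings, Finset.mem_filter_univ]
          rw [← Finset.sum_filter, hfilter, Finset.sum_const, nsmul_eq_mul, mul_comm]
  rw [Finset.sum_congr rfl fun H _ => hdiv H, ← Finset.sum_div, hsum, div_mul_eq_mul_div]

lemma oplusFold_nonneg {n m : ℕ} (d : Fin m → ℕ) (H : SimpleGraph (Fin n)) :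
    0 ≤ oplusFold m (fun i => mu n (d i)) H := by
  have hmu : ∀ i G, 0 ≤ mu n (d i) G := fun i G => by
    unfold mu
    split_ifs <;> positivity
  have hmass : ∀ H, 0 ≤ oplusFoldMass m (fun i => mu n (d i)) H := fun H => by
    refine tsum_nonneg fun f => ?_
    split_ifs
    · exact Finset.prod_nonneg fun i _ => hmu i _
    · exact le_rfl
  exact div_nonneg (hmass H) (tsum_nonneg hmass)

lemma oplusMass_eq_sum {n : ℕ} (p q : SimpleGraph (Fin n) → ℝ) (G : SimpleGraph (Fin n)) :
    oplusMass p q G = ∑ H, p H * ∑ H', if Disjoint H H' ∧ H ⊔ H' = G then q H' else 0 := by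
  rw [oplusMass, tsum_fintype, Fintype.sum_prod_type]
  simp only [Finset.mul_sum, mul_ite, mul_zero]

lemma tvDist_oplus_le {n m g : ℕ} (d : Fin m → ℕ) (hm : 1 ≤ m) (hg : 1 ≤ g) (hd : ∀ i, 1 ≤ d i)
    (hn : (g + ∑ i, d i) ^ 3 ≤ n) {η η' : SimpleGraph (Fin n) → ℝ} (hη : IsProbC η)
    (hη' : IsProbC η') (hs : ∀ G, η G ≠ 0 → IsRegularGraph G g)
    (hs' : ∀ G, η' G ≠ 0 → IsRegularGraph G g) :
    tvDist (oplus η (oplusFold m fun i => mu n (d i)))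
      (oplus η' (oplusFold m fun i => mu n (d i))) ≤ 2 * Real.exp 11 * tvDist η η' := by
  have hD2 : 2 ≤ g + ∑ i, d i := by
    have := Finset.single_le_sum (f := d) (fun i _ => Nat.zero_le _)
      (Finset.mem_univ (⟨0, hm⟩ : Fin m))
    have := hd ⟨0, hm⟩
    omega
  obtain ⟨c, hc, hsum⟩ := exists_sum_oplusFold_eq (n := n) d
  have hrow : ∀ F : SimpleGraph (Fin n), ∑ G, ∑ H, (if Disjoint F H ∧ F ⊔ H = G then
      oplusFold m (fun i => mu n (d i)) H else 0) = c * (packings d F).card := fun F => by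
    rw [← hsum, Finset.sum_comm]
    refine Finset.sum_congr rfl fun H _ => ?_
    simp only [ite_and, Finset.sum_ite_irrel, Finset.sum_ite_eq, Finset.mem_univ, if_true,
      Finset.sum_const_zero]
  have key := sum_abs_normalized_sub_le (K := Real.exp 11) (P := fun G => IsRegularGraph G g)
    (q := fun F G : SimpleGraph (Fin n) => ∑ H, (if Disjoint F H ∧ F ⊔ H = G then
      oplusFold m (fun i => mu n (d i)) H else 0))
    (fun F G => Finset.sum_nonneg fun H _ => by
      split_ifs
      · exact oplusFold_nonneg d H
      · exact le_rfl) (Real.exp_pos _).le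
    (fun G G' hG hG' => by
      rw [hrow, hrow, mul_left_comm]
      refine mul_le_mul_of_nonneg_left ?_ hc
      simp only [IsRegularGraph, gDeg_eq_degree] at hG hG'
      exact card_packings_le_exp_mul hG hG' hd rfl hD2 (by simpa using hn))
    hη.1 ((tsum_fintype _).symm.trans hη.2) hη'.1 ((tsum_fintype _).symm.trans hη'.2) hs hs'
  simp only [tvDist, oplus, oplusMass_eq_sum, tsum_fintype]
  linarith

end RegularPacking

/-- There is an absolute constant `C > 0` such that for any `n`,
`k ≥ 2`, degrees `d_1, …, d_k ≥ 1` with `d_i n` even and `(∑ d_i)^3 ≤ n`, and any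
probability measures `η, η̃` on `𝒢_{d_1}(n)`, setting `τ = μ_{d_2,n} ⊕ ⋯ ⊕ μ_{d_k,n}`,
we have `d_TV(η ⊕ τ, η̃ ⊕ τ) ≤ C d_TV(η, η̃)`. -/
theorem statement_9 :
    ∃ C : ℝ, 0 < C ∧
      ∀ (n k : ℕ) (d : Fin k → ℕ) (hn : 1 ≤ n) (hk : 2 ≤ k),
        (∀ i, 1 ≤ d i) →
        (∀ i, Even (d i * n)) →
        (∑ i, d i) ^ 3 ≤ n →
        ∀ η η' : SimpleGraph (Fin n) → ℝ,
          IsProbC η → IsProbC η' →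
          (∀ G, η G ≠ 0 → IsRegularGraph G (d ⟨0, by omega⟩)) →
          (∀ G, η' G ≠ 0 → IsRegularGraph G (d ⟨0, by omega⟩)) →
          tvDist
            (oplus η (oplusFold (k-1) (fun i => mu n (d ⟨i.1 + 1, by
              have := i.isLt; omega⟩))))
            (oplus η' (oplusFold (k-1) (fun i => mu n (d ⟨i.1 + 1, by
              have := i.isLt; omega⟩)))) ≤
          C * tvDist η η' := by
  refine ⟨2 * Real.exp 11, by positivity, ?_⟩
  intro n k d hn hk hd _ hD η η' hη hη' hs hs'
  obtain ⟨m, rfl⟩ : ∃ m, k = m + 1 := ⟨k - 1, by omega⟩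
  rw [Fin.sum_univ_succ] at hD
  exact RegularPacking.tvDist_oplus_le (fun i : Fin m => d i.succ) (by omega) (hd 0)
    (fun i => hd i.succ) hD hη hη' hs hs'
end
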